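/- arXiv:2311.10772 — 2 statements merged into one kernel-verified Lean document; each statement's English description precedes it below -/
import Mathlib

section
/- Let T_A = PA₁ ∩ QA₂, T_B = PB₁ ∩ QB₂, T_C = PC₁ ∩ QC₂, let R be the common point of the lines AA', BB', CC' (where A' is the second intersection of the circumcircles of AB₁C₁ and AB₂C₂, and B', C' analogous), let S_t be the common point, on the circumcircle of ABC, of the lines through A, B, C parallel to T_BT_C, T_CT_A, T_AT_B respectively, and let T_a be the antipode of S_t on the circumcircle of ABC. Then there is an orientation-reversing similarity of the plane sending A to T_A, B to T_B, C to T_C, S_t to R, and T_a to O. -/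
open EuclideanGeometry

theorem Complex.eq_zero_of_dot_eq_zero {n m z : ℂ} (h : n.re * m.im - n.im * m.re ≠ 0)
    (hn : n.re * z.re + n.im * z.im = 0) (hm : m.re * z.re + m.im * z.im = 0) : z = 0 := by
  apply Complex.ext
  · apply mul_left_cancel₀ h
    simp only [Complex.zero_re]
    linear_combination m.im * hn - n.im * hm
  · apply mul_left_cancel₀ h
    simp only [Complex.zero_im]
    linear_combination n.re * hm - m.re * hn

/-- A vector orthogonal to the unit vector `n` is a real multiple of `n * I`. -/
theorem Complex.eq_mul_I_of_dot_eq_zero {n z : ℂ} (hn : n.re ^ 2 + n.im ^ 2 = 1)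
    (h : n.re * z.re + n.im * z.im = 0) : ∃ t : ℝ, z = n * (t * Complex.I) := by
  refine ⟨n.re * z.im - n.im * z.re, ?_⟩
  apply Complex.ext
  · simp
    linear_combination n.re * h - z.re * hn
  · simp
    linear_combination n.im * h - z.im * hn

theorem exists_real_of_mem_line {B C X : ℂ} (h : X ∈ line[ℝ, B, C]) :
    ∃ t : ℝ, X = B + t * (C - B) := by
  obtain ⟨t, rfl⟩ := mem_affineSpan_pair_iff_exists_lineMap_eq.1 h
  exact ⟨t, by simp [AffineMap.lineMap_apply, add_comm]⟩

theorem Complex.dist_eq_dist_iff {p q r s : ℂ} : dist p q = dist r s ↔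
    (p.re - q.re) ^ 2 + (p.im - q.im) ^ 2 = (r.re - s.re) ^ 2 + (r.im - s.im) ^ 2 := by
  rw [← sq_eq_sq₀ dist_nonneg dist_nonneg, Complex.dist_eq, Complex.dist_eq, Complex.sq_norm,
    Complex.sq_norm, Complex.normSq_apply, Complex.normSq_apply]
  simp only [Complex.sub_re, Complex.sub_im, ← sq]

/-- A chord `X₁X₂` of a circle centred at `O`, described by the unit normal `n` of its line, the
signed distance `d` of the line from `O` and the signed half-length `h`. -/
theorem exists_chord_normal_form {O B C X₁ X₂ : ℂ} (hne : X₁ ≠ X₂)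
    (hdist : dist X₁ O = dist X₂ O) (h₁ : X₁ ∈ line[ℝ, B, C]) (h₂ : X₂ ∈ line[ℝ, B, C]) :
    ∃ (n : ℂ) (d h : ℝ), n.re ^ 2 + n.im ^ 2 = 1 ∧ h ≠ 0 ∧
      X₁ = O + n * (d + h * Complex.I) ∧ X₂ = O + n * (d - h * Complex.I) ∧
      n.re * (B - O).re + n.im * (B - O).im = d ∧
      n.re * (C - O).re + n.im * (C - O).im = d := by
  obtain ⟨s, rfl⟩ := exists_real_of_mem_line h₁
  obtain ⟨t, rfl⟩ := exists_real_of_mem_line h₂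
  have hBC : C - B ≠ 0 := fun h => hne (by simp [h])
  have hst : s - t ≠ 0 := fun h => hne (by rw [sub_eq_zero.1 h])
  set L := ‖C - B‖ with hL
  have hL0 : L ≠ 0 := norm_ne_zero_iff.2 hBC
  have hL2 : (C.re - B.re) ^ 2 + (C.im - B.im) ^ 2 = L ^ 2 := by
    rw [hL, Complex.sq_norm, Complex.normSq_apply]
    simp only [Complex.sub_re, Complex.sub_im, ← sq]
  rw [Complex.dist_eq_dist_iff] at hdist
  simp at hdist
  have key : (s + t) * L ^ 2 + 2 * ((C.re - B.re) * (B.re - O.re) +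
      (C.im - B.im) * (B.im - O.im)) = 0 := by
    apply mul_left_cancel₀ hst
    linear_combination hdist - (s - t) * (s + t) * hL2
  refine ⟨⟨(C.im - B.im) / L, -(C.re - B.re) / L⟩,
    ((C.im - B.im) * (B.re - O.re) - (C.re - B.re) * (B.im - O.im)) / L, (s - t) * L / 2,
    ?_, ?_, ?_, ?_, ?_, ?_⟩
  · field_simp
    linear_combination hL2
  · positivity
  · apply Complex.ext
    · simp
      field_simp
      linear_combination (C.re - B.re) * key - 2 * (B.re - O.re) * hL2
    · simp
      field_simp
      linear_combination (C.im - B.im) * key - 2 * (B.im - O.im) * hL2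
  · apply Complex.ext
    · simp
      field_simp
      linear_combination (C.re - B.re) * key - 2 * (B.re - O.re) * hL2
    · simp
      field_simp
      linear_combination (C.im - B.im) * key - 2 * (B.im - O.im) * hL2
  · simp
    field_simp
    ring
  · simp
    field_simp
    ring

/-- The centre `c`, relative to `A`, of a circle through `A`, `X`, `Y`, `P`. -/
theorem exists_center_of_cospherical {A X Y P : ℂ} (h : Cospherical ({A, X, Y, P} : Set ℂ)) :
    ∃ c : ℂ, ∀ Z ∈ ({X, Y, P} : Set ℂ),
      (Z - A).re ^ 2 + (Z - A).im ^ 2 = 2 * (c.re * (Z - A).re + c.im * (Z - A).im) := by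
  obtain ⟨c, r, hc⟩ := h
  have hA := hc A (by simp)
  refine ⟨c - A, fun Z hZ => ?_⟩
  have hZ' := hc Z (Set.mem_insert_of_mem _ hZ)
  rw [← hA, Complex.dist_eq_dist_iff] at hZ'
  simp only [Complex.sub_re, Complex.sub_im]
  linear_combination hZ'

/-- If `X` lies on the line through `A` with unit normal `n`, the equation of a circle through
`A` and `X` gives the directed length `AX`. -/
theorem directed_length_eq_of_circle {A X c n : ℂ} {x : ℝ} (hn : n.re ^ 2 + n.im ^ 2 = 1)
    (hXA : X ≠ A) (hx : X - A = n * (x * Complex.I))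
    (h : (X - A).re ^ 2 + (X - A).im ^ 2 = 2 * (c.re * (X - A).re + c.im * (X - A).im)) :
    x = 2 * (c.im * n.re - c.re * n.im) := by
  have hx0 : x ≠ 0 := by
    rintro rfl
    exact hXA (sub_eq_zero.1 (by simpa using hx))
  rw [hx] at h
  simp at h
  apply mul_left_cancel₀ hx0
  linear_combination h - x ^ 2 * hn

/-- The inscribed angle theorem: the lines `PX` and `PY` make the same directed angle with the
lines `AX` and `AY`. -/
theorem parallel_of_cospherical {A X Y P n m : ℂ} (h : Cospherical ({A, X, Y, P} : Set ℂ))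
    (hn : n.re ^ 2 + n.im ^ 2 = 1) (hm : m.re ^ 2 + m.im ^ 2 = 1) (hXA : X ≠ A) (hYA : Y ≠ A)
    (hX : n.re * (X - A).re + n.im * (X - A).im = 0)
    (hY : m.re * (Y - A).re + m.im * (Y - A).im = 0) :
    (n.re * (P - X).re + n.im * (P - X).im) * (m.re * (P - Y).im - m.im * (P - Y).re) =
    (n.re * (P - X).im - n.im * (P - X).re) * (m.re * (P - Y).re + m.im * (P - Y).im) := by
  obtain ⟨c, hc⟩ := exists_center_of_cospherical h
  obtain ⟨x, hx⟩ := Complex.eq_mul_I_of_dot_eq_zero hn hX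
  obtain ⟨y, hy⟩ := Complex.eq_mul_I_of_dot_eq_zero hm hY
  have ex := directed_length_eq_of_circle hn hXA hx (hc X (by simp))
  have ey := directed_length_eq_of_circle hm hYA hy (hc Y (by simp))
  have hP := hc P (by simp)
  have e1 : P - X = (P - A) - n * (x * Complex.I) := by rw [← hx]; ring
  have e2 : P - Y = (P - A) - m * (y * Complex.I) := by rw [← hy]; ring
  rw [e1, e2]
  generalize P - A = p at *
  have dn : n.re * (p - n * (x * Complex.I)).re + n.im * (p - n * (x * Complex.I)).im =
      n.re * p.re + n.im * p.im := by simp; ring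
  have dm : m.re * (p - m * (y * Complex.I)).re + m.im * (p - m * (y * Complex.I)).im =
      m.re * p.re + m.im * p.im := by simp; ring
  have cn : n.re * (p - n * (x * Complex.I)).im - n.im * (p - n * (x * Complex.I)).re =
      n.re * p.im - n.im * p.re - x := by simp; linear_combination -x * hn
  have cm : m.re * (p - m * (y * Complex.I)).im - m.im * (p - m * (y * Complex.I)).re =
      m.re * p.im - m.im * p.re - y := by simp; linear_combination -y * hm
  rw [dn, dm, cn, cm]
  linear_combination (n.im * m.re - n.re * m.im) * hP + (m.re * p.re + m.im * p.im) * ex -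
    (n.re * p.re + n.im * p.im) * ey

/-- The common directed angle that the lines from a Miquel point make with the side lines, as a
ratio `k : m`. -/
theorem exists_common_direction {p q r : ℂ} (hpq : p.re * q.im = p.im * q.re)
    (hqr : q.re * r.im = q.im * r.re) (hrp : r.re * p.im = r.im * p.re)
    (h : p ≠ 0 ∨ q ≠ 0) :
    ∃ k m : ℝ, (k ≠ 0 ∨ m ≠ 0) ∧ m * p.re + k * p.im = 0 ∧ m * q.re + k * q.im = 0 ∧
      m * r.re + k * r.im = 0 := by
  have aux : ∀ z : ℂ, z ≠ 0 → z.re ≠ 0 ∨ -z.im ≠ 0 := by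
    intro z hz
    by_contra! hc
    exact hz (Complex.ext (by simpa using hc.1) (by simpa using hc.2))
  by_cases hp : p = 0
  · refine ⟨q.re, -q.im, aux q (h.resolve_left (not_not.2 hp)), ?_, ?_, ?_⟩ <;>
      linarith
  · refine ⟨p.re, -p.im, aux p hp, ?_, ?_, ?_⟩ <;> linarith

theorem collinear_iff_det_eq_zero {A B C : ℂ} : Collinear ℝ ({A, B, C} : Set ℂ) ↔
    (B - A).re * (C - A).im - (B - A).im * (C - A).re = 0 := by
  constructor
  · intro h
    rw [collinear_iff_of_mem (p₀ := A) (by simp)] at h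
    obtain ⟨v, hv⟩ := h
    obtain ⟨s, hs⟩ := hv B (by simp)
    obtain ⟨t, ht⟩ := hv C (by simp)
    rw [hs, ht]
    simp
    ring
  · intro h
    rw [collinear_iff_of_mem (p₀ := A) (by simp)]
    by_cases hBA : B - A = 0
    · refine ⟨C - A, ?_⟩
      rintro p (rfl | rfl | rfl)
      · exact ⟨0, by simp⟩
      · exact ⟨0, by simp [sub_eq_zero.1 hBA]⟩
      · exact ⟨1, by simp⟩
    · refine ⟨B - A, ?_⟩
      have hpos : (B - A).re ^ 2 + (B - A).im ^ 2 ≠ 0 := by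
        rw [sq, sq, ← Complex.normSq_apply]
        exact mt Complex.normSq_eq_zero.1 hBA
      rintro p (rfl | rfl | rfl)
      · exact ⟨0, by simp⟩
      · exact ⟨1, by simp⟩
      · refine ⟨((B - A).re * (p - A).re + (B - A).im * (p - A).im) /
          ((B - A).re ^ 2 + (B - A).im ^ 2), ?_⟩
        rw [vadd_eq_add, ← sub_eq_iff_eq_add]
        generalize p - A = c at *
        generalize B - A = b at *
        apply Complex.ext <;> simp only [Complex.smul_re, Complex.smul_im, smul_eq_mul]
        · field_simp
          linear_combination -b.im * h
        · field_simp
          linear_combination b.re * h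

/-- A nondegenerate triangle `ABC` whose side lines `BC`, `CA`, `AB` have unit normals `n₁`, `n₂`,
`n₃` and lie at signed distances `d₁`, `d₂`, `d₃` from `O`. -/
structure TriangleNormals (O A B C n₁ n₂ n₃ : ℂ) (d₁ d₂ d₃ : ℝ) : Prop where
  unit₁ : n₁.re ^ 2 + n₁.im ^ 2 = 1
  unit₂ : n₂.re ^ 2 + n₂.im ^ 2 = 1
  unit₃ : n₃.re ^ 2 + n₃.im ^ 2 = 1
  B_mem₁ : n₁.re * (B - O).re + n₁.im * (B - O).im = d₁
  C_mem₁ : n₁.re * (C - O).re + n₁.im * (C - O).im = d₁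
  C_mem₂ : n₂.re * (C - O).re + n₂.im * (C - O).im = d₂
  A_mem₂ : n₂.re * (A - O).re + n₂.im * (A - O).im = d₂
  A_mem₃ : n₃.re * (A - O).re + n₃.im * (A - O).im = d₃
  B_mem₃ : n₃.re * (B - O).re + n₃.im * (B - O).im = d₃
  det_ne_zero : (B - A).re * (C - A).im - (B - A).im * (C - A).re ≠ 0

namespace TriangleNormals

variable {O A B C n₁ n₂ n₃ : ℂ} {d₁ d₂ d₃ : ℝ}

theorem rotate (T : TriangleNormals O A B C n₁ n₂ n₃ d₁ d₂ d₃) :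
    TriangleNormals O B C A n₂ n₃ n₁ d₂ d₃ d₁ where
  unit₁ := T.unit₂
  unit₂ := T.unit₃
  unit₃ := T.unit₁
  B_mem₁ := T.C_mem₂
  C_mem₁ := T.A_mem₂
  C_mem₂ := T.A_mem₃
  A_mem₂ := T.B_mem₃
  A_mem₃ := T.B_mem₁
  B_mem₃ := T.C_mem₁
  det_ne_zero := by
    have := T.det_ne_zero
    contrapose! this
    simp at this ⊢
    linear_combination this

theorem exists_sub_eq (T : TriangleNormals O A B C n₁ n₂ n₃ d₁ d₂ d₃) :
    ∃ t : ℝ, B - A = n₃ * (t * Complex.I) := by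
  apply Complex.eq_mul_I_of_dot_eq_zero T.unit₃
  have h₁ := T.A_mem₃
  have h₂ := T.B_mem₃
  simp at h₁ h₂ ⊢
  linear_combination h₂ - h₁

theorem cross_ne_zero (T : TriangleNormals O A B C n₁ n₂ n₃ d₁ d₂ d₃) :
    n₂.re * n₃.im - n₂.im * n₃.re ≠ 0 := by
  obtain ⟨s, hs⟩ := T.exists_sub_eq
  obtain ⟨t, ht⟩ := T.rotate.rotate.exists_sub_eq
  have hd := T.det_ne_zero
  rw [← neg_sub A C, ht, hs] at hd
  contrapose! hd
  simp
  linear_combination s * t * hd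

theorem not_concurrent (T : TriangleNormals O A B C n₁ n₂ n₃ d₁ d₂ d₃) {z : ℂ}
    (h₁ : n₁.re * z.re + n₁.im * z.im = d₁) (h₂ : n₂.re * z.re + n₂.im * z.im = d₂)
    (h₃ : n₃.re * z.re + n₃.im * z.im = d₃) : False := by
  have key : ∀ {A B C n₁ n₂ n₃ : ℂ} {d₁ d₂ d₃ : ℝ},
      TriangleNormals O A B C n₁ n₂ n₃ d₁ d₂ d₃ → n₂.re * z.re + n₂.im * z.im = d₂ →
      n₃.re * z.re + n₃.im * z.im = d₃ → A = O + z := by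
    intro A B C n₁ n₂ n₃ d₁ d₂ d₃ T h₂ h₃
    have e₂ := T.A_mem₂
    have e₃ := T.A_mem₃
    rw [← sub_eq_zero]
    apply Complex.eq_zero_of_dot_eq_zero T.cross_ne_zero
    · simp at e₂ ⊢
      linear_combination e₂ - h₂
    · simp at e₃ ⊢
      linear_combination e₃ - h₃
  apply T.det_ne_zero
  rw [key T h₂ h₃, key T.rotate h₃ h₁]
  simp

/-- A Miquel point `P` of points `X`, `Y`, `Z` on the side lines sees these side lines along
directions making a common directed angle with them, of ratio `k : m`. -/
theorem exists_direction_of_miquel (T : TriangleNormals O A B C n₁ n₂ n₃ d₁ d₂ d₃)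
    {X Y Z P : ℂ} (hXY : X ≠ Y) (hXB : X ≠ B) (hXC : X ≠ C) (hYC : Y ≠ C) (hYA : Y ≠ A)
    (hZA : Z ≠ A) (hZB : Z ≠ B)
    (hX : n₁.re * (X - O).re + n₁.im * (X - O).im = d₁)
    (hY : n₂.re * (Y - O).re + n₂.im * (Y - O).im = d₂)
    (hZ : n₃.re * (Z - O).re + n₃.im * (Z - O).im = d₃)
    (h₁ : Cospherical ({A, Y, Z, P} : Set ℂ)) (h₂ : Cospherical ({B, Z, X, P} : Set ℂ))
    (h₃ : Cospherical ({C, X, Y, P} : Set ℂ)) :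
    ∃ k m : ℝ, (k ≠ 0 ∨ m ≠ 0) ∧
      m * (n₁.re * (P - X).re + n₁.im * (P - X).im) +
        k * (n₁.re * (P - X).im - n₁.im * (P - X).re) = 0 ∧
      m * (n₂.re * (P - Y).re + n₂.im * (P - Y).im) +
        k * (n₂.re * (P - Y).im - n₂.im * (P - Y).re) = 0 ∧
      m * (n₃.re * (P - Z).re + n₃.im * (P - Z).im) +
        k * (n₃.re * (P - Z).im - n₃.im * (P - Z).re) = 0 := by
  have dot_sub : ∀ {n U V : ℂ} {d : ℝ}, n.re * (U - O).re + n.im * (U - O).im = d →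
      n.re * (V - O).re + n.im * (V - O).im = d →
      n.re * (U - V).re + n.im * (U - V).im = 0 := by
    intro n U V d hU hV
    simp at hU hV ⊢
    linear_combination hU - hV
  have p₁ := parallel_of_cospherical h₁ T.unit₂ T.unit₃ hYA hZA (dot_sub hY T.A_mem₂)
    (dot_sub hZ T.A_mem₃)
  have p₂ := parallel_of_cospherical h₂ T.unit₃ T.unit₁ hZB hXB (dot_sub hZ T.B_mem₃)
    (dot_sub hX T.B_mem₁)
  have p₃ := parallel_of_cospherical h₃ T.unit₁ T.unit₂ hXC hYC (dot_sub hX T.C_mem₁)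
    (dot_sub hY T.C_mem₂)
  have eq_zero : ∀ {n z : ℂ}, n.re ^ 2 + n.im ^ 2 = 1 →
      (⟨n.re * z.re + n.im * z.im, n.re * z.im - n.im * z.re⟩ : ℂ) = 0 → z = 0 := by
    intro n z hn h
    have hre := congrArg Complex.re h
    have him := congrArg Complex.im h
    simp at hre him
    apply Complex.ext
    · simp
      linear_combination n.re * hre - n.im * him - z.re * hn
    · simp
      linear_combination n.im * hre + n.re * him - z.im * hn
  refine exists_common_direction
    (p := ⟨n₁.re * (P - X).re + n₁.im * (P - X).im, n₁.re * (P - X).im - n₁.im * (P - X).re⟩)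
    (q := ⟨n₂.re * (P - Y).re + n₂.im * (P - Y).im, n₂.re * (P - Y).im - n₂.im * (P - Y).re⟩)
    (r := ⟨n₃.re * (P - Z).re + n₃.im * (P - Z).im, n₃.re * (P - Z).im - n₃.im * (P - Z).re⟩)
    p₃ p₁ p₂ ?_
  by_contra! hc
  exact hXY (by rw [← sub_eq_zero.1 (eq_zero T.unit₁ hc.1), ← sub_eq_zero.1 (eq_zero T.unit₂ hc.2)])

/-- The point `O + w` opposite to `O` on the circle through `P`, `Q` and the three intersection
points, with `κ` the ratio by which `O + w` moves the side lines towards their half-chords. -/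
theorem exists_antipode (T : TriangleNormals O A B C n₁ n₂ n₃ d₁ d₂ d₃)
    {h₁ h₂ h₃ k m k' m' : ℝ} {P Q T_A : ℂ} (hh₁ : h₁ ≠ 0)
    (hkm : k ≠ 0 ∨ m ≠ 0) (hkm' : k' ≠ 0 ∨ m' ≠ 0)
    (hP₁ : m * (n₁.re * (P - O).re + n₁.im * (P - O).im) +
      k * (n₁.re * (P - O).im - n₁.im * (P - O).re) = m * d₁ + k * h₁)
    (hP₂ : m * (n₂.re * (P - O).re + n₂.im * (P - O).im) +
      k * (n₂.re * (P - O).im - n₂.im * (P - O).re) = m * d₂ + k * h₂)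
    (hP₃ : m * (n₃.re * (P - O).re + n₃.im * (P - O).im) +
      k * (n₃.re * (P - O).im - n₃.im * (P - O).re) = m * d₃ + k * h₃)
    (hQ₁ : m' * (n₁.re * (Q - O).re + n₁.im * (Q - O).im) +
      k' * (n₁.re * (Q - O).im - n₁.im * (Q - O).re) = m' * d₁ - k' * h₁)
    (hQ₂ : m' * (n₂.re * (Q - O).re + n₂.im * (Q - O).im) +
      k' * (n₂.re * (Q - O).im - n₂.im * (Q - O).re) = m' * d₂ - k' * h₂)
    (hQ₃ : m' * (n₃.re * (Q - O).re + n₃.im * (Q - O).im) +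
      k' * (n₃.re * (Q - O).im - n₃.im * (Q - O).re) = m' * d₃ - k' * h₃)
    (hTP : m * (n₁.re * (T_A - O).re + n₁.im * (T_A - O).im) +
      k * (n₁.re * (T_A - O).im - n₁.im * (T_A - O).re) = m * d₁ + k * h₁)
    (hTQ : m' * (n₁.re * (T_A - O).re + n₁.im * (T_A - O).im) +
      k' * (n₁.re * (T_A - O).im - n₁.im * (T_A - O).re) = m' * d₁ - k' * h₁) :
    m ≠ 0 ∧ k' ≠ 0 ∧ m * k' + m' * k = 0 ∧ ∃ w : ℂ,
      m * (n₁.re * w.re + n₁.im * w.im) = m * d₁ + k * h₁ ∧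
      m * (n₂.re * w.re + n₂.im * w.im) = m * d₂ + k * h₂ ∧
      m * (n₃.re * w.re + n₃.im * w.im) = m * d₃ + k * h₃ := by
  have hc : m * k' + m' * k = 0 := by
    by_contra hc
    -- the common point of the three lines, obtained by eliminating the `hᵢ`
    refine T.not_concurrent (z := ((k' * m + k * m' : ℝ) : ℂ)⁻¹ *
      (k' * ((P - O) * (m - k * Complex.I)) + k * ((Q - O) * (m' - k' * Complex.I)))) ?_ ?_ ?_
    all_goals
      rw [← Complex.ofReal_inv, Complex.re_ofReal_mul, Complex.im_ofReal_mul]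
      have hc' : k' * m + k * m' ≠ 0 := by
        contrapose! hc
        linear_combination hc
      field_simp
      simp at hP₁ hP₂ hP₃ hQ₁ hQ₂ hQ₃ ⊢
    · linear_combination k' * hP₁ + k * hQ₁
    · linear_combination k' * hP₂ + k * hQ₂
    · linear_combination k' * hP₃ + k * hQ₃
  have hk : k ≠ 0 := by
    rintro rfl
    have hm := hkm.resolve_left (not_not.2 rfl)
    refine T.not_concurrent (z := P - O) ?_ ?_ ?_ <;> apply mul_left_cancel₀ hm <;> linarith
  have hk' : k' ≠ 0 := by
    rintro rfl
    have hm := hkm'.resolve_left (not_not.2 rfl)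
    refine T.not_concurrent (z := Q - O) ?_ ?_ ?_ <;> apply mul_left_cancel₀ hm <;> linarith
  have hm : m ≠ 0 := by
    rintro rfl
    have hm' : m' = 0 := by simpa [hk] using hc
    subst hm'
    have e₁ : n₁.re * (T_A - O).im - n₁.im * (T_A - O).re = h₁ :=
      mul_left_cancel₀ hk (by linarith)
    have e₂ : n₁.re * (T_A - O).im - n₁.im * (T_A - O).re = -h₁ :=
      mul_left_cancel₀ hk' (by linarith)
    exact hh₁ (by linarith)
  refine ⟨hm, hk', hc, (m : ℂ)⁻¹ * ((P - O) * (m - k * Complex.I)), ?_, ?_, ?_⟩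
  all_goals
    rw [← Complex.ofReal_inv, Complex.re_ofReal_mul, Complex.im_ofReal_mul]
    field_simp
    simp at hP₁ hP₂ hP₃ ⊢
  · linear_combination hP₁
  · linear_combination hP₂
  · linear_combination hP₃

end TriangleNormals

/-- An intersection point seen from `P` and `Q` along mirror directions is the projection of
`O + w` on the perpendicular from `O` to the side line. -/
theorem eq_projection {n w z : ℂ} {d h k m k' m' : ℝ} (hn : n.re ^ 2 + n.im ^ 2 = 1)
    (hk' : k' ≠ 0) (hm : m ≠ 0) (hc : m * k' + m' * k = 0)
    (hw : m * (n.re * w.re + n.im * w.im) = m * d + k * h)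
    (hP : m * (n.re * z.re + n.im * z.im) + k * (n.re * z.im - n.im * z.re) = m * d + k * h)
    (hQ : m' * (n.re * z.re + n.im * z.im) + k' * (n.re * z.im - n.im * z.re) =
      m' * d - k' * h) :
    z = n * ((n.re * w.re + n.im * w.im : ℝ) : ℂ) := by
  have him : n.re * z.im - n.im * z.re = 0 := by
    apply mul_left_cancel₀ (mul_ne_zero (two_ne_zero (α := ℝ)) (mul_ne_zero hm hk'))
    linear_combination m * hQ - m' * hP + (n.re * z.im - n.im * z.re - h) * hc
  have hre : n.re * z.re + n.im * z.im = n.re * w.re + n.im * w.im := by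
    apply mul_left_cancel₀ hm
    linear_combination hP - hw - k * him
  rw [← hre]
  apply Complex.ext
  · simp
    linear_combination -n.im * him - z.re * hn
  · simp
    linear_combination n.re * him - z.im * hn

/-- A point of the line `PX` satisfies the direction equation of that line. -/
theorem direction_of_mem_line {n O P X Z : ℂ} {d h k m : ℝ} (hn : n.re ^ 2 + n.im ^ 2 = 1)
    (hX : X = O + n * (d + h * Complex.I)) (hZ : Z ∈ line[ℝ, P, X])
    (hP : m * (n.re * (P - X).re + n.im * (P - X).im) +
        k * (n.re * (P - X).im - n.im * (P - X).re) = 0) :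
    m * (n.re * (Z - O).re + n.im * (Z - O).im) +
      k * (n.re * (Z - O).im - n.im * (Z - O).re) = m * d + k * h := by
  obtain ⟨t, rfl⟩ := exists_real_of_mem_line hZ
  subst hX
  simp at hP ⊢
  linear_combination (1 - t) * hP + (m * d + k * h) * hn

theorem Complex.mul_conj_eq_one {n : ℂ} (hn : n.re ^ 2 + n.im ^ 2 = 1) :
    n * (starRingEnd ℂ) n = 1 := by
  rw [Complex.mul_conj, Complex.normSq_apply, ← sq, ← sq, hn, Complex.ofReal_one]

theorem Complex.ofReal_dot (n w : ℂ) : ((n.re * w.re + n.im * w.im : ℝ) : ℂ) =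
    ((starRingEnd ℂ) n * w + n * (starRingEnd ℂ) w) / 2 := by
  rw [eq_div_iff two_ne_zero]
  apply Complex.ext
  · simp
    ring
  · simp
    ring

theorem Complex.ofReal_cross_mul_I (n m : ℂ) :
    ((n.re * m.im - n.im * m.re : ℝ) : ℂ) * Complex.I =
      ((starRingEnd ℂ) n * m - n * (starRingEnd ℂ) m) / 2 := by
  rw [eq_div_iff two_ne_zero]
  apply Complex.ext
  · simp
  · simp
    ring

namespace TriangleNormals

variable {O A B C n₁ n₂ n₃ : ℂ} {d₁ d₂ d₃ : ℝ}

/-- The law of sines. -/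
theorem exists_sine_law (T : TriangleNormals O A B C n₁ n₂ n₃ d₁ d₂ d₃) :
    ∃ l : ℝ, l ≠ 0 ∧
      C - B = n₁ * ((l * (n₂.re * n₃.im - n₂.im * n₃.re) : ℝ) * Complex.I) ∧
      A - C = n₂ * ((l * (n₃.re * n₁.im - n₃.im * n₁.re) : ℝ) * Complex.I) ∧
      B - A = n₃ * ((l * (n₁.re * n₂.im - n₁.im * n₂.re) : ℝ) * Complex.I) := by
  obtain ⟨x₃, hx₃⟩ := T.exists_sub_eq
  obtain ⟨x₁, hx₁⟩ := T.rotate.exists_sub_eq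
  obtain ⟨x₂, hx₂⟩ := T.rotate.rotate.exists_sub_eq
  have hs₁ := T.cross_ne_zero
  have hsum : n₁ * (x₁ * Complex.I) + n₂ * (x₂ * Complex.I) + n₃ * (x₃ * Complex.I) = 0 := by
    rw [← hx₁, ← hx₂, ← hx₃]
    ring
  have hre := congrArg Complex.re hsum
  have him := congrArg Complex.im hsum
  simp at hre him
  have hx₁0 : x₁ ≠ 0 := by
    rintro rfl
    apply T.rotate.det_ne_zero
    rw [hx₁]
    simp
  have e₂ : x₂ = x₁ / (n₂.re * n₃.im - n₂.im * n₃.re) * (n₃.re * n₁.im - n₃.im * n₁.re) := by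
    field_simp
    linear_combination n₃.re * hre + n₃.im * him
  have e₃ : x₃ = x₁ / (n₂.re * n₃.im - n₂.im * n₃.re) * (n₁.re * n₂.im - n₁.im * n₂.re) := by
    field_simp
    linear_combination -n₂.re * hre - n₂.im * him
  refine ⟨x₁ / (n₂.re * n₃.im - n₂.im * n₃.re), div_ne_zero hx₁0 hs₁, ?_, ?_, ?_⟩
  · rw [hx₁, div_mul_cancel₀ _ hs₁]
  · rw [hx₂, e₂]
  · rw [hx₃, e₃]

/-- The projections of `O + w` on the perpendiculars from `O` to the sides form a triangle
inversely similar to `ABC`. -/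
theorem exists_similarity (T : TriangleNormals O A B C n₁ n₂ n₃ d₁ d₂ d₃) {w : ℂ} (hw : w ≠ 0)
    {T_A T_B T_C : ℂ}
    (hA : T_A - O = n₁ * ((n₁.re * w.re + n₁.im * w.im : ℝ) : ℂ))
    (hB : T_B - O = n₂ * ((n₂.re * w.re + n₂.im * w.im : ℝ) : ℂ))
    (hC : T_C - O = n₃ * ((n₃.re * w.re + n₃.im * w.im : ℝ) : ℂ)) :
    ∃ a b : ℂ, a ≠ 0 ∧
      T_A = a * (starRingEnd ℂ) A + b ∧
      T_B = a * (starRingEnd ℂ) B + b ∧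
      T_C = a * (starRingEnd ℂ) C + b := by
  obtain ⟨l, hl, h₁, h₂, h₃⟩ := T.exists_sine_law
  have hu₁ := Complex.mul_conj_eq_one T.unit₁
  have hu₂ := Complex.mul_conj_eq_one T.unit₂
  have hu₃ := Complex.mul_conj_eq_one T.unit₃
  have hl' : (l : ℂ) ≠ 0 := Complex.ofReal_ne_zero.2 hl
  rw [Complex.ofReal_mul, mul_assoc (l : ℂ), Complex.ofReal_cross_mul_I] at h₂ h₃
  rw [Complex.ofReal_dot] at hA hB hC
  have e₂ := congrArg (starRingEnd ℂ) h₂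
  have e₃ := congrArg (starRingEnd ℂ) h₃
  simp only [map_sub, map_mul, map_div₀, Complex.conj_conj, Complex.conj_ofReal, map_ofNat]
    at e₂ e₃
  refine ⟨-(n₁ * n₂ * n₃ * (starRingEnd ℂ) w / l),
    T_A + n₁ * n₂ * n₃ * (starRingEnd ℂ) w / l * (starRingEnd ℂ) A, ?_, by ring, ?_, ?_⟩
  · have h0 : ∀ {z u : ℂ}, z * u = 1 → z ≠ 0 := fun h => left_ne_zero_of_mul (h ▸ one_ne_zero)
    have hw' : (starRingEnd ℂ) w ≠ 0 := (map_ne_zero _).2 hw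
    exact neg_ne_zero.2 (div_ne_zero (mul_ne_zero (mul_ne_zero (mul_ne_zero (h0 hu₁) (h0 hu₂))
      (h0 hu₃)) hw') hl')
  · have e : (starRingEnd ℂ) B = (starRingEnd ℂ) A + (starRingEnd ℂ) n₃ *
        (l * ((n₁ * (starRingEnd ℂ) n₂ - (starRingEnd ℂ) n₁ * n₂) / 2)) := by
      linear_combination e₃
    rw [e]
    generalize (starRingEnd ℂ) n₁ = u₁ at *
    generalize (starRingEnd ℂ) n₂ = u₂ at *
    generalize (starRingEnd ℂ) n₃ = u₃ at *
    have cancel : ∀ K X Y Z : ℂ, -(K / l) * (X + Y * (l * Z)) + (T_A + K / l * X) =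
        T_A - K * Y * Z := by
      intro K X Y Z
      field_simp
      ring
    rw [cancel]
    linear_combination hB - hA + w / 2 * (hu₂ - hu₁) +
      n₁ * n₂ * (starRingEnd ℂ) w * (n₁ * u₂ - u₁ * n₂) / 2 * hu₃ +
      (starRingEnd ℂ) w / 2 * (n₁ ^ 2 * hu₂ - n₂ ^ 2 * hu₁)
  · have e : (starRingEnd ℂ) C = (starRingEnd ℂ) A - (starRingEnd ℂ) n₂ *
        (l * ((n₃ * (starRingEnd ℂ) n₁ - (starRingEnd ℂ) n₃ * n₁) / 2)) := by
      linear_combination -e₂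
    rw [e]
    generalize (starRingEnd ℂ) n₁ = u₁ at *
    generalize (starRingEnd ℂ) n₂ = u₂ at *
    generalize (starRingEnd ℂ) n₃ = u₃ at *
    have cancel : ∀ K X Y Z : ℂ, -(K / l) * (X - Y * (l * Z)) + (T_A + K / l * X) =
        T_A + K * Y * Z := by
      intro K X Y Z
      field_simp
      ring
    rw [cancel]
    linear_combination hC - hA + w / 2 * (hu₃ - hu₁) -
      n₁ * n₃ * (starRingEnd ℂ) w * (n₃ * u₁ - u₃ * n₁) / 2 * hu₂ +
      (starRingEnd ℂ) w / 2 * (n₁ ^ 2 * hu₃ - n₃ ^ 2 * hu₁)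

/-- The common point of the parallels through the vertices is mapped to `O + w`. -/
theorem map_common_point (T : TriangleNormals O A B C n₁ n₂ n₃ d₁ d₂ d₃) {w a b S : ℂ}
    {T_A T_B T_C : ℂ}
    (hA : T_A - O = n₁ * ((n₁.re * w.re + n₁.im * w.im : ℝ) : ℂ))
    (hB : T_B - O = n₂ * ((n₂.re * w.re + n₂.im * w.im : ℝ) : ℂ))
    (eA : T_A = a * (starRingEnd ℂ) A + b) (eB : T_B = a * (starRingEnd ℂ) B + b)
    (eC : T_C = a * (starRingEnd ℂ) C + b)
    (hSA : ∃ t : ℝ, S - A = t • (T_C - T_B)) (hSB : ∃ t : ℝ, S - B = t • (T_A - T_C)) :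
    a * (starRingEnd ℂ) S + b = O + w := by
  have key : ∀ {n X Y Z T_X T_Y T_Z : ℂ} {d : ℝ}, n.re ^ 2 + n.im ^ 2 = 1 →
      n.re * (Y - O).re + n.im * (Y - O).im = d → n.re * (Z - O).re + n.im * (Z - O).im = d →
      T_X - O = n * ((n.re * w.re + n.im * w.im : ℝ) : ℂ) →
      T_X = a * (starRingEnd ℂ) X + b → T_Y = a * (starRingEnd ℂ) Y + b →
      T_Z = a * (starRingEnd ℂ) Z + b → (∃ t : ℝ, S - X = t • (T_Z - T_Y)) →
      n.re * (a * (starRingEnd ℂ) S + b - (O + w)).re +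
        n.im * (a * (starRingEnd ℂ) S + b - (O + w)).im = 0 := by
    rintro n X Y Z T_X T_Y T_Z d hn hY hZ hX eX eY eZ ⟨t, ht⟩
    have e : a * (starRingEnd ℂ) S + b - (O + w) =
        n * ((n.re * w.re + n.im * w.im : ℝ) : ℂ) - w + (t * Complex.normSq a : ℝ) * (Z - Y) := by
      have h := congrArg (starRingEnd ℂ) ht
      rw [eY, eZ] at h
      simp at h
      rw [Complex.ofReal_mul, ← Complex.mul_conj]
      linear_combination hX - eX + a * h
    rw [e]
    simp at hY hZ ⊢
    linear_combination (n.re * w.re + n.im * w.im) * hn + t * Complex.normSq a * (hZ - hY)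
  rw [← sub_eq_zero]
  exact Complex.eq_zero_of_dot_eq_zero T.rotate.rotate.cross_ne_zero
    (key T.unit₁ T.B_mem₁ T.C_mem₁ hA eA eB eC hSA)
    (key T.unit₂ T.C_mem₂ T.A_mem₂ hB eB eC eA hSB)

/-- If two circles through `A`, cutting the side lines through `A` in chords of the given circle,
meet again at `A'`, then `O + w` lies on the line `AA'`. -/
theorem radical_axis (T : TriangleNormals O A B C n₁ n₂ n₃ d₁ d₂ d₃) {h₂ h₃ k m : ℝ}
    {w Y₁ Y₂ Z₁ Z₂ A' R : ℂ} (hm : m ≠ 0)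
    (hw₂ : m * (n₂.re * w.re + n₂.im * w.im) = m * d₂ + k * h₂)
    (hw₃ : m * (n₃.re * w.re + n₃.im * w.im) = m * d₃ + k * h₃)
    (hY₁ : Y₁ = O + n₂ * (d₂ + h₂ * Complex.I)) (hY₂ : Y₂ = O + n₂ * (d₂ - h₂ * Complex.I))
    (hZ₁ : Z₁ = O + n₃ * (d₃ + h₃ * Complex.I)) (hZ₂ : Z₂ = O + n₃ * (d₃ - h₃ * Complex.I))
    (hY₁A : Y₁ ≠ A) (hY₂A : Y₂ ≠ A) (hZ₁A : Z₁ ≠ A) (hZ₂A : Z₂ ≠ A)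
    (hA'₁ : Cospherical ({A, Y₁, Z₁, A'} : Set ℂ)) (hA'₂ : Cospherical ({A, Y₂, Z₂, A'} : Set ℂ))
    (hR : R ∈ line[ℝ, A, A']) :
    (R - A).re * (O + w - A).im - (R - A).im * (O + w - A).re = 0 := by
  obtain ⟨c, hc⟩ := exists_center_of_cospherical hA'₁
  obtain ⟨c', hc'⟩ := exists_center_of_cospherical hA'₂
  have key : ∀ {n X₁ X₂ : ℂ} {d h : ℝ}, n.re ^ 2 + n.im ^ 2 = 1 →
      n.re * (A - O).re + n.im * (A - O).im = d →
      m * (n.re * w.re + n.im * w.im) = m * d + k * h →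
      X₁ = O + n * (d + h * Complex.I) → X₂ = O + n * (d - h * Complex.I) →
      X₁ ≠ A → X₂ ≠ A →
      (X₁ - A).re ^ 2 + (X₁ - A).im ^ 2 = 2 * (c.re * (X₁ - A).re + c.im * (X₁ - A).im) →
      (X₂ - A).re ^ 2 + (X₂ - A).im ^ 2 = 2 * (c'.re * (X₂ - A).re + c'.im * (X₂ - A).im) →
      n.re * (m * (O + w - A) + k * ((c - c') * Complex.I)).re +
        n.im * (m * (O + w - A) + k * ((c - c') * Complex.I)).im = 0 := by
    intro n X₁ X₂ d h hn hA hw hX₁ hX₂ hX₁A hX₂A hcX hcX'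
    obtain ⟨x, hx⟩ := Complex.eq_mul_I_of_dot_eq_zero (z := X₁ - A) hn (by
      rw [hX₁]
      simp at hA ⊢
      linear_combination d * hn - hA)
    have hx' : X₂ - A = n * ((x - 2 * h : ℝ) * Complex.I) := by
      rw [hX₁] at hx
      rw [hX₂]
      push_cast
      linear_combination hx
    have e := directed_length_eq_of_circle hn hX₁A hx hcX
    have e' := directed_length_eq_of_circle hn hX₂A hx' hcX'
    simp at hA ⊢
    linear_combination hw - m * hA + k / 2 * (e - e')
  have hv := Complex.eq_zero_of_dot_eq_zero T.cross_ne_zero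
    (key T.unit₂ T.A_mem₂ hw₂ hY₁ hY₂ hY₁A hY₂A (hc Y₁ (by simp)) (hc' Y₂ (by simp)))
    (key T.unit₃ T.A_mem₃ hw₃ hZ₁ hZ₂ hZ₁A hZ₂A (hc Z₁ (by simp)) (hc' Z₂ (by simp)))
  have e := hc A' (by simp)
  have e' := hc' A' (by simp)
  obtain ⟨t, rfl⟩ := exists_real_of_mem_line hR
  have hre := congrArg Complex.re hv
  have him := congrArg Complex.im hv
  simp at hre him e e' ⊢
  apply mul_left_cancel₀ hm
  linear_combination t * (A'.re - A.re) * him - t * (A'.im - A.im) * hre + t * k / 2 * (e - e')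

theorem eq_of_collinear_vertices (T : TriangleNormals O A B C n₁ n₂ n₃ d₁ d₂ d₃) {R W : ℂ}
    (hA : (R - A).re * (W - A).im - (R - A).im * (W - A).re = 0)
    (hB : (R - B).re * (W - B).im - (R - B).im * (W - B).re = 0)
    (hC : (R - C).re * (W - C).im - (R - C).im * (W - C).re = 0) : R = W := by
  have hd := T.det_ne_zero
  rw [← sub_eq_zero]
  apply Complex.eq_zero_of_dot_eq_zero (n := (B - A) * Complex.I) (m := (C - A) * Complex.I)
  · contrapose! hd
    simp at hd ⊢
    linear_combination hd
  · simp at hA hB ⊢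
    linear_combination hB - hA
  · simp at hA hC ⊢
    linear_combination hC - hA

end TriangleNormals

/-- The points `T_A`, `T_B`, `T_C` lie on the circle with diameter from `O` to `O + w`, and an
inverse similarity preserves circumcentres. -/
theorem map_circumcenter {O A B C M w a b T_A T_B T_C n₁ n₂ n₃ : ℂ}
    (hn₁ : n₁.re ^ 2 + n₁.im ^ 2 = 1) (hn₂ : n₂.re ^ 2 + n₂.im ^ 2 = 1)
    (hn₃ : n₃.re ^ 2 + n₃.im ^ 2 = 1) (hT : ¬ Collinear ℝ ({T_A, T_B, T_C} : Set ℂ))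
    (hA : T_A - O = n₁ * ((n₁.re * w.re + n₁.im * w.im : ℝ) : ℂ))
    (hB : T_B - O = n₂ * ((n₂.re * w.re + n₂.im * w.im : ℝ) : ℂ))
    (hC : T_C - O = n₃ * ((n₃.re * w.re + n₃.im * w.im : ℝ) : ℂ))
    (eA : T_A = a * (starRingEnd ℂ) A + b) (eB : T_B = a * (starRingEnd ℂ) B + b)
    (eC : T_C = a * (starRingEnd ℂ) C + b)
    (hAB : dist A M = dist B M) (hAC : dist A M = dist C M) :
    a * (starRingEnd ℂ) M + b = O + w / 2 := by
  have hmap : ∀ X : ℂ, dist (a * (starRingEnd ℂ) X + b) (a * (starRingEnd ℂ) M + b) =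
      ‖a‖ * dist X M := by
    intro X
    rw [dist_add_right, Complex.dist_eq, ← mul_sub, ← map_sub, norm_mul, Complex.norm_conj,
      Complex.dist_eq]
  have hAB' : dist T_A (a * (starRingEnd ℂ) M + b) = dist T_B (a * (starRingEnd ℂ) M + b) := by
    rw [eA, eB, hmap, hmap, hAB]
  have hAC' : dist T_A (a * (starRingEnd ℂ) M + b) = dist T_C (a * (starRingEnd ℂ) M + b) := by
    rw [eA, eC, hmap, hmap, hAC]
  have thales : ∀ {n X : ℂ}, n.re ^ 2 + n.im ^ 2 = 1 →
      X - O = n * ((n.re * w.re + n.im * w.im : ℝ) : ℂ) →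
      (X.re - O.re) ^ 2 + (X.im - O.im) ^ 2 = (X.re - O.re) * w.re + (X.im - O.im) * w.im := by
    intro n X hn hX
    rw [← Complex.sub_re, ← Complex.sub_im, hX, Complex.re_mul_ofReal, Complex.im_mul_ofReal]
    linear_combination (n.re * w.re + n.im * w.im) ^ 2 * hn
  have tA := thales hn₁ hA
  have tB := thales hn₂ hB
  have tC := thales hn₃ hC
  rw [Complex.dist_eq_dist_iff] at hAB' hAC'
  rw [collinear_iff_det_eq_zero] at hT
  generalize a * (starRingEnd ℂ) M + b = μ at *
  rw [← sub_eq_zero]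
  have hw : w / 2 = ⟨w.re / 2, w.im / 2⟩ := by apply Complex.ext <;> simp
  rw [hw]
  apply Complex.eq_zero_of_dot_eq_zero hT
  · simp
    linear_combination (1 / 2) * (hAB' - tA + tB)
  · simp
    linear_combination (1 / 2) * (hAC' - tA + tC)

/- STATEMENT 13: There is an orientation-reversing similarity (in ℂ: z ↦ a * conj z + b
with a ≠ 0) sending A ↦ T_A, B ↦ T_B, C ↦ T_C, S_t ↦ R and T_a ↦ O.
The plane is modelled by ℂ. -/

theorem similarity_ABC_St_Ta_to_TATBTC_R_O
    (A B C O : ℂ)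
    -- triangle ABC is nondegenerate
    (hABC : AffineIndependent ℝ ![A, B, C])
    -- Γ is a circle with center O meeting the sidelines in the six points
    (Γ : EuclideanGeometry.Sphere ℂ) (hO : Γ.center = O)
    (A₁ A₂ B₁ B₂ C₁ C₂ : ℂ)
    (hA₁Γ : A₁ ∈ Γ) (hA₂Γ : A₂ ∈ Γ) (hB₁Γ : B₁ ∈ Γ)
    (hB₂Γ : B₂ ∈ Γ) (hC₁Γ : C₁ ∈ Γ) (hC₂Γ : C₂ ∈ Γ)
    (hA₁ : A₁ ∈ line[ℝ, B, C]) (hA₂ : A₂ ∈ line[ℝ, B, C])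
    (hB₁ : B₁ ∈ line[ℝ, C, A]) (hB₂ : B₂ ∈ line[ℝ, C, A])
    (hC₁ : C₁ ∈ line[ℝ, A, B]) (hC₂ : C₂ ∈ line[ℝ, A, B])
    -- the six points are distinct from each other and from the vertices
    (hdist : List.Pairwise (· ≠ ·) [A, B, C, A₁, A₂, B₁, B₂, C₁, C₂])
    -- P is the Miquel point of A₁B₁C₁ in ABC, Q that of A₂B₂C₂
    (P Q : ℂ)
    (hP₁ : Cospherical ({A, B₁, C₁, P} : Set ℂ))
    (hP₂ : Cospherical ({B, C₁, A₁, P} : Set ℂ))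
    (hP₃ : Cospherical ({C, A₁, B₁, P} : Set ℂ))
    (hQ₁ : Cospherical ({A, B₂, C₂, Q} : Set ℂ))
    (hQ₂ : Cospherical ({B, C₂, A₂, Q} : Set ℂ))
    (hQ₃ : Cospherical ({C, A₂, B₂, Q} : Set ℂ))
    -- T_A = PA₁ ∩ QA₂, T_B = PB₁ ∩ QB₂, T_C = PC₁ ∩ QC₂
    (T_A T_B T_C : ℂ)
    (hTA₁ : T_A ∈ line[ℝ, P, A₁]) (hTA₂ : T_A ∈ line[ℝ, Q, A₂])
    (hTB₁ : T_B ∈ line[ℝ, P, B₁]) (hTB₂ : T_B ∈ line[ℝ, Q, B₂])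
    (hTC₁ : T_C ∈ line[ℝ, P, C₁]) (hTC₂ : T_C ∈ line[ℝ, Q, C₂])
    (hT : ¬ Collinear ℝ ({T_A, T_B, T_C} : Set ℂ))
    -- A' is the second intersection of circles (AB₁C₁) and (AB₂C₂); B', C' analogous
    (A' B' C' : ℂ)
    (hA'₁ : Cospherical ({A, B₁, C₁, A'} : Set ℂ))
    (hA'₂ : Cospherical ({A, B₂, C₂, A'} : Set ℂ)) (hA'A : A' ≠ A)
    (hB'₁ : Cospherical ({B, C₁, A₁, B'} : Set ℂ))
    (hB'₂ : Cospherical ({B, C₂, A₂, B'} : Set ℂ)) (hB'B : B' ≠ B)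
    (hC'₁ : Cospherical ({C, A₁, B₁, C'} : Set ℂ))
    (hC'₂ : Cospherical ({C, A₂, B₂, C'} : Set ℂ)) (hC'C : C' ≠ C)
    -- R is the common point of the lines AA', BB', CC'
    (R : ℂ)
    (hRA : R ∈ line[ℝ, A, A']) (hRB : R ∈ line[ℝ, B, B']) (hRC : R ∈ line[ℝ, C, C'])
    -- ω is the circumcircle of triangle ABC
    (ω : EuclideanGeometry.Sphere ℂ)
    (hAω : A ∈ ω) (hBω : B ∈ ω) (hCω : C ∈ ω)
    -- S_t is the common point, on the circumcircle of ABC, of the lines through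
    -- A, B, C parallel to T_BT_C, T_CT_A, T_AT_B respectively
    (S_t : ℂ) (hSω : S_t ∈ ω)
    (hSA : ∃ t : ℝ, S_t - A = t • (T_C - T_B))
    (hSB : ∃ t : ℝ, S_t - B = t • (T_A - T_C))
    (hSC : ∃ t : ℝ, S_t - C = t • (T_B - T_A))
    -- T_a is the antipode of S_t on the circumcircle of ABC
    (T_a : ℂ) (hTa : midpoint ℝ S_t T_a = ω.center)
    :
    -- conclusion
    ∃ a b : ℂ, a ≠ 0 ∧
      T_A = a * (starRingEnd ℂ) A + b ∧
      T_B = a * (starRingEnd ℂ) B + b ∧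
      T_C = a * (starRingEnd ℂ) C + b ∧
      R = a * (starRingEnd ℂ) S_t + b ∧
      O = a * (starRingEnd ℂ) T_a + b := by
  simp only [List.pairwise_cons, List.mem_cons, List.not_mem_nil, or_false, forall_eq_or_imp,
    forall_eq] at hdist
  obtain ⟨⟨-, -, -, -, hAB₁, hAB₂, hAC₁, hAC₂⟩, ⟨-, hBA₁, hBA₂, -, -, hBC₁, hBC₂⟩,
    ⟨hCA₁, hCA₂, hCB₁, hCB₂, -, -⟩, ⟨hAA, hA₁B₁, -, -, -⟩, ⟨-, hA₂B₂, -, -⟩, ⟨hBB, -, -⟩,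
    -, hCC, -⟩ := hdist
  have hΓ : ∀ {X Y : ℂ}, X ∈ Γ → Y ∈ Γ → dist X O = dist Y O := by
    intro X Y hX hY
    rw [← hO, EuclideanGeometry.mem_sphere.1 hX, EuclideanGeometry.mem_sphere.1 hY]
  obtain ⟨n₁, d₁, h₁, hn₁, hh₁, eA₁, eA₂, hd₁, hd₁'⟩ :=
    exists_chord_normal_form hAA (hΓ hA₁Γ hA₂Γ) hA₁ hA₂
  obtain ⟨n₂, d₂, h₂, hn₂, -, eB₁, eB₂, hd₂, hd₂'⟩ :=
    exists_chord_normal_form hBB (hΓ hB₁Γ hB₂Γ) hB₁ hB₂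
  obtain ⟨n₃, d₃, h₃, hn₃, -, eC₁, eC₂, hd₃, hd₃'⟩ :=
    exists_chord_normal_form hCC (hΓ hC₁Γ hC₂Γ) hC₁ hC₂
  have hdet : (B - A).re * (C - A).im - (B - A).im * (C - A).re ≠ 0 := by
    rw [affineIndependent_iff_not_collinear_set] at hABC
    exact mt collinear_iff_det_eq_zero.2 hABC
  have T : TriangleNormals O A B C n₁ n₂ n₃ d₁ d₂ d₃ :=
    ⟨hn₁, hn₂, hn₃, hd₁, hd₁', hd₂, hd₂', hd₃, hd₃', hdet⟩
  have dot_pos : ∀ {n X : ℂ} {d h : ℝ}, n.re ^ 2 + n.im ^ 2 = 1 →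
      X = O + n * (d + h * Complex.I) → n.re * (X - O).re + n.im * (X - O).im = d := by
    rintro n X d h hn rfl
    simp
    linear_combination d * hn
  have to_neg : ∀ {n X : ℂ} {d h : ℝ}, X = O + n * (d - h * Complex.I) →
      X = O + n * (d + (-h : ℝ) * Complex.I) := by
    rintro n X d h rfl
    push_cast
    ring
  have eA₂' := to_neg eA₂
  have eB₂' := to_neg eB₂
  have eC₂' := to_neg eC₂
  obtain ⟨k, m, hkm, p₁, p₂, p₃⟩ := T.exists_direction_of_miquel hA₁B₁ hBA₁.symm hCA₁.symm
    hCB₁.symm hAB₁.symm hAC₁.symm hBC₁.symm (dot_pos hn₁ eA₁) (dot_pos hn₂ eB₁)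
    (dot_pos hn₃ eC₁) hP₁ hP₂ hP₃
  obtain ⟨k', m', hkm', q₁, q₂, q₃⟩ := T.exists_direction_of_miquel hA₂B₂ hBA₂.symm hCA₂.symm
    hCB₂.symm hAB₂.symm hAC₂.symm hBC₂.symm (dot_pos hn₁ eA₂') (dot_pos hn₂ eB₂')
    (dot_pos hn₃ eC₂') hQ₁ hQ₂ hQ₃
  have tA := direction_of_mem_line hn₁ eA₁ hTA₁ p₁
  have tB := direction_of_mem_line hn₂ eB₁ hTB₁ p₂
  have tC := direction_of_mem_line hn₃ eC₁ hTC₁ p₃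
  have tA' := direction_of_mem_line hn₁ eA₂' hTA₂ q₁
  have tB' := direction_of_mem_line hn₂ eB₂' hTB₂ q₂
  have tC' := direction_of_mem_line hn₃ eC₂' hTC₂ q₃
  have P₁ := direction_of_mem_line hn₁ eA₁ (left_mem_affineSpan_pair ℝ P A₁) p₁
  have P₂ := direction_of_mem_line hn₂ eB₁ (left_mem_affineSpan_pair ℝ P B₁) p₂
  have P₃ := direction_of_mem_line hn₃ eC₁ (left_mem_affineSpan_pair ℝ P C₁) p₃
  have Q₁ := direction_of_mem_line hn₁ eA₂' (left_mem_affineSpan_pair ℝ Q A₂) q₁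
  have Q₂ := direction_of_mem_line hn₂ eB₂' (left_mem_affineSpan_pair ℝ Q B₂) q₂
  have Q₃ := direction_of_mem_line hn₃ eC₂' (left_mem_affineSpan_pair ℝ Q C₂) q₃
  rw [mul_neg, ← sub_eq_add_neg] at tA' tB' tC' Q₁ Q₂ Q₃
  obtain ⟨hm, hk', hc, w, w₁, w₂, w₃⟩ :=
    T.exists_antipode hh₁ hkm hkm' P₁ P₂ P₃ Q₁ Q₂ Q₃ tA tA'
  have fA := eq_projection hn₁ hk' hm hc w₁ tA tA'
  have fB := eq_projection hn₂ hk' hm hc w₂ tB tB'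
  have fC := eq_projection hn₃ hk' hm hc w₃ tC tC'
  have hw : w ≠ 0 := by
    rintro rfl
    simp [sub_eq_zero] at fA fB fC
    rw [fA, fB, fC] at hT
    exact hT (by simpa using collinear_singleton ℝ O)
  obtain ⟨a, b, ha, eA, eB, eC⟩ := T.exists_similarity hw fA fB fC
  have hR : R = O + w := T.eq_of_collinear_vertices
    (T.radical_axis hm w₂ w₃ eB₁ eB₂ eC₁ eC₂ hAB₁.symm hAB₂.symm hAC₁.symm hAC₂.symm
      hA'₁ hA'₂ hRA)
    (T.rotate.radical_axis hm w₃ w₁ eC₁ eC₂ eA₁ eA₂ hBC₁.symm hBC₂.symm hBA₁.symm hBA₂.symm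
      hB'₁ hB'₂ hRB)
    (T.rotate.rotate.radical_axis hm w₁ w₂ eA₁ eA₂ eB₁ eB₂ hCA₁.symm hCA₂.symm hCB₁.symm
      hCB₂.symm hC'₁ hC'₂ hRC)
  have hS := T.map_common_point fA fB eA eB eC hSA hSB
  have hω : ∀ {X : ℂ}, X ∈ ω → dist A ω.center = dist X ω.center := by
    intro X hX
    rw [EuclideanGeometry.mem_sphere.1 hAω, EuclideanGeometry.mem_sphere.1 hX]
  have hM := map_circumcenter hn₁ hn₂ hn₃ hT fA fB fC eA eB eC (hω hBω) (hω hCω)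
  have hTa' : T_a = 2 * ω.center - S_t := by
    rw [← hTa, midpoint_eq_smul_add]
    simp
    ring
  refine ⟨a, b, ha, eA, eB, eC, hR.trans hS.symm, ?_⟩
  rw [hTa']
  simp only [map_sub, map_mul, map_ofNat]
  linear_combination hS - 2 * hM
end

section
/- Let T_A = PA₁ ∩ QA₂, T_B = PB₁ ∩ QB₂, T_C = PC₁ ∩ QC₂, let R be the common point of the lines AA', BB', CC' (where A' is the second intersection of the circumcircles of AB₁C₁ and AB₂C₂, and B', C' analogous), and let S_t be the common point, on the circumcircle of ABC, of the lines through A, B, C parallel to T_BT_C, T_CT_A, T_AT_B respectively. Let the line OR meet the lines BC, CA, AB at X, Y, Z respectively, and let O_A, O_B, O_C be the circumcenters of triangles AYZ, BZX, CXY. Then the triangles ABC and O_AO_BO_C are perspective at S_t, i.e. the lines AO_A, BO_B, CO_C all pass through S_t. -/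
open EuclideanGeometry

/- STATEMENT 17: Let the line OR meet BC, CA, AB at X, Y, Z and let O_A, O_B, O_C be
the circumcenters of triangles AYZ, BZX, CXY. Then triangles ABC and O_AO_BO_C are
perspective at the generalized Steiner point S_t: the lines AO_A, BO_B, CO_C all pass
through S_t.  The plane is modelled by ℂ. -/

/-- The signed area form on the plane. -/
def planeCross (u v : ℂ) : ℝ := u.re * v.im - u.im * v.re

/-- The Euclidean inner product on the plane. -/
def planeDot (u v : ℂ) : ℝ := u.re * v.re + u.im * v.im

lemma exists_eq_add_of_mem_line {U V W : ℂ} (h : W ∈ line[ℝ, U, V]) :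
    ∃ t : ℝ, W = U + t * (V - U) := by
  obtain ⟨t, rfl⟩ := mem_affineSpan_pair_iff_exists_lineMap_eq.1 h
  exact ⟨t, by simp [AffineMap.lineMap_apply]; ring⟩

lemma exists_eq_add_of_mem_line_right {U V W : ℂ} (h : W ∈ line[ℝ, U, V]) :
    ∃ t : ℝ, W = V + t * (V - U) := by
  obtain ⟨t, rfl⟩ := exists_eq_add_of_mem_line h
  exact ⟨t - 1, by push_cast; ring⟩

lemma planeDot_sub_self_eq_of_dist_eq {a b c d : ℂ} (h : dist a b = dist c d) :
    planeDot (a - b) (a - b) = planeDot (c - d) (c - d) := by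
  have h2 : dist a b ^ 2 = dist c d ^ 2 := by rw [h]
  simpa [Complex.dist_eq, Complex.sq_norm, Complex.normSq_apply, planeDot] using h2

lemma eq_zero_of_planeDot_self {u : ℂ} (h : planeDot u u = 0) : u = 0 := by
  apply Complex.normSq_eq_zero.1
  simpa [Complex.normSq_apply, planeDot] using h

lemma planeDot_self_ne_zero {u : ℂ} (h : u ≠ 0) : planeDot u u ≠ 0 :=
  fun h' => h (eq_zero_of_planeDot_self h')

/-- A vector is determined by its inner product and area with a nonzero vector. -/
lemma eq_mul_of_planeDot_of_planeCross {u w : ℂ} {c x : ℝ} (hu : u ≠ 0)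
    (hc : planeDot u w = c * planeDot u u) (hx : planeCross u w = x * planeDot u u) :
    w = (c + x * Complex.I) * u := by
  have hn := planeDot_self_ne_zero hu
  apply Complex.ext
  · apply mul_left_cancel₀ hn
    simp [planeCross, planeDot, -mul_eq_mul_left_iff] at hc hx ⊢
    linear_combination u.re * hc - u.im * hx
  · apply mul_left_cancel₀ hn
    simp [planeCross, planeDot, -mul_eq_mul_left_iff] at hc hx ⊢
    linear_combination u.im * hc + u.re * hx

/-- The projection of the center `K` of a circle on its chord from `A` to `A + β e`. -/
lemma two_mul_planeDot_of_equidistant {A K e : ℂ} {β : ℝ} (hne : A + β * e ≠ A)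
    (h : dist K A = dist K (A + β * e)) :
    2 * planeDot (K - A) e = β * planeDot e e := by
  have hβ : β ≠ 0 := by
    rintro rfl
    simp at hne
  have h' := planeDot_sub_self_eq_of_dist_eq h
  simp only [planeDot, Complex.sub_re, Complex.sub_im, Complex.add_re, Complex.add_im,
    Complex.re_ofReal_mul, Complex.im_ofReal_mul] at h' ⊢
  apply mul_left_cancel₀ hβ
  linear_combination h'

/-- Inscribed angles: the lines from `P` to `E` and `F` make equal directed angles with the lines
`A + ℝ e` and `A + ℝ f` on which `E` and `F` lie. -/
lemma planeCross_mul_planeDot_of_cospherical {A E F P e f : ℂ} (hEA : A ≠ E) (hFA : A ≠ F)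
    (hE : ∃ t : ℝ, E = A + t * e) (hF : ∃ t : ℝ, F = A + t * f)
    (h : Cospherical ({A, E, F, P} : Set ℂ)) :
    planeCross e (P - E) * planeDot f (P - F) = planeCross f (P - F) * planeDot e (P - E) := by
  obtain ⟨K, ρ, hK⟩ := h
  obtain ⟨β, rfl⟩ := hE
  obtain ⟨γ, rfl⟩ := hF
  have hA := hK A (by simp)
  have hE := hK (A + β * e) (by simp)
  have hF := hK (A + γ * f) (by simp)
  have hP := hK P (by simp)
  have h₁ : dist K A = dist K P := by rw [dist_comm K, dist_comm K, hA, hP]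
  have h₂ : dist K A = dist K (A + β * e) := by rw [dist_comm K, dist_comm K, hA, hE]
  have h₃ : dist K A = dist K (A + γ * f) := by rw [dist_comm K, dist_comm K, hA, hF]
  have h₁ := planeDot_sub_self_eq_of_dist_eq h₁
  have h₂ := two_mul_planeDot_of_equidistant hEA.symm h₂
  have h₃ := two_mul_planeDot_of_equidistant hFA.symm h₃
  simp only [planeDot, planeCross, Complex.sub_re, Complex.sub_im, Complex.add_re,
    Complex.add_im, Complex.re_ofReal_mul, Complex.im_ofReal_mul] at h₁ h₂ h₃ ⊢
  linear_combination (-h₁) * (e.re * f.im - e.im * f.re) +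
    (e.re * (P.im - A.im) - e.im * (P.re - A.re)) * h₃ -
    (f.re * (P.im - A.im) - f.im * (P.re - A.re)) * h₂

/-- The common directed angle between the sides and the lines joining the Miquel point to the
points `D`, `E`, `F` on the sides. -/
lemma miquel_direction {A B C D E F P : ℂ}
    (hD : D ∈ line[ℝ, B, C]) (hE : E ∈ line[ℝ, C, A]) (hF : F ∈ line[ℝ, A, B])
    (hBD : B ≠ D) (hCD : C ≠ D) (hCE : C ≠ E) (hAE : A ≠ E) (hAF : A ≠ F) (hBF : B ≠ F)
    (hA : Cospherical ({A, E, F, P} : Set ℂ)) (hB : Cospherical ({B, F, D, P} : Set ℂ))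
    (hC : Cospherical ({C, D, E, P} : Set ℂ)) {N : ℝ}
    (hN : planeDot (C - B) (P - D) + planeDot (A - C) (P - E) + planeDot (B - A) (P - F) = N) :
    planeCross (C - B) (P - D) * N = planeCross (B - A) (C - A) * planeDot (C - B) (P - D) ∧
    planeCross (A - C) (P - E) * N = planeCross (B - A) (C - A) * planeDot (A - C) (P - E) ∧
    planeCross (B - A) (P - F) * N = planeCross (B - A) (C - A) * planeDot (B - A) (P - F) := by
  have h₁ := planeCross_mul_planeDot_of_cospherical hAE hAF
    (exists_eq_add_of_mem_line_right hE) (exists_eq_add_of_mem_line hF) hA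
  have h₂ := planeCross_mul_planeDot_of_cospherical hBF hBD
    (exists_eq_add_of_mem_line_right hF) (exists_eq_add_of_mem_line hD) hB
  have h₃ := planeCross_mul_planeDot_of_cospherical hCD hCE
    (exists_eq_add_of_mem_line_right hD) (exists_eq_add_of_mem_line hE) hC
  have hS : planeCross (C - B) (P - D) + planeCross (A - C) (P - E) + planeCross (B - A) (P - F) =
      planeCross (B - A) (C - A) := by
    obtain ⟨s, rfl⟩ := exists_eq_add_of_mem_line hD
    obtain ⟨t, rfl⟩ := exists_eq_add_of_mem_line hE
    obtain ⟨u, rfl⟩ := exists_eq_add_of_mem_line hF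
    simp only [planeCross, Complex.sub_re, Complex.sub_im, Complex.add_re,
      Complex.add_im, Complex.re_ofReal_mul, Complex.im_ofReal_mul]
    ring
  rw [← hN, ← hS]
  refine ⟨?_, ?_, ?_⟩
  · linear_combination h₃ - h₂
  · linear_combination h₁ - h₃
  · linear_combination h₂ - h₁

/-- A chord on the line `BC` of a circle with center `O`, described by the foot of the
perpendicular from `O` and the half-chord. -/
lemma exists_chord_parameters {B C D E O : ℂ} {Γ : EuclideanGeometry.Sphere ℂ} (hO : Γ.center = O)
    (hD : D ∈ Γ) (hE : E ∈ Γ) (hDl : D ∈ line[ℝ, B, C]) (hEl : E ∈ line[ℝ, B, C]) (hDE : D ≠ E) :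
    ∃ p δ : ℝ, p ≠ 0 ∧ D = O - (δ * Complex.I + p) * (C - B) ∧
      E = O + (-δ * Complex.I + p) * (C - B) ∧
      planeCross (C - B) (O - B) = δ * planeDot (C - B) (C - B) := by
  have hd : dist O D = dist O E := by
    rw [dist_comm O, dist_comm O, ← hO, EuclideanGeometry.mem_sphere.1 hD,
      EuclideanGeometry.mem_sphere.1 hE]
  obtain ⟨s, rfl⟩ := exists_eq_add_of_mem_line hDl
  obtain ⟨t, rfl⟩ := exists_eq_add_of_mem_line hEl
  have hst : s - t ≠ 0 := by
    intro h
    exact hDE (by rw [sub_eq_zero.1 h])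
  have he : C - B ≠ 0 := by
    intro h
    simp [h] at hDE
  have hn := planeDot_self_ne_zero he
  have hd := planeDot_sub_self_eq_of_dist_eq hd
  have hm : 2 * planeDot (C - B) (O - B) = (s + t) * planeDot (C - B) (C - B) := by
    apply mul_left_cancel₀ hst
    simp only [planeDot, Complex.sub_re, Complex.sub_im, Complex.add_re, Complex.add_im,
      Complex.re_ofReal_mul, Complex.im_ofReal_mul] at hd ⊢
    linear_combination -hd
  obtain ⟨δ, hδ⟩ : ∃ δ : ℝ, planeCross (C - B) (O - B) = δ * planeDot (C - B) (C - B) :=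
    ⟨_, (div_mul_cancel₀ _ hn).symm⟩
  have hOB : O - B = (((s + t) / 2 : ℝ) + δ * Complex.I) * (C - B) :=
    eq_mul_of_planeDot_of_planeCross he (by linear_combination hm / 2) hδ
  refine ⟨(t - s) / 2, δ, ?_, ?_, ?_, hδ⟩
  · intro h
    exact hst (by linarith)
  · push_cast at hOB ⊢
    linear_combination -hOB
  · push_cast at hOB ⊢
    linear_combination -hOB

/-- The intersection of the lines `PD` and `QE` lies on the perpendicular bisector of `DE`. -/
lemma miquel_lines_inter {D E O P Q T e : ℂ} {p δ N S : ℝ} (he : e ≠ 0) (hN : N ≠ 0) (hS : S ≠ 0)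
    (hD : D = O - (δ * Complex.I + p) * e) (hE : E = O + (-δ * Complex.I + p) * e)
    (hP : planeCross e (P - D) * N = S * planeDot e (P - D))
    (hQ : planeCross e (Q - E) * -N = S * planeDot e (Q - E))
    (hTP : T ∈ line[ℝ, P, D]) (hTQ : T ∈ line[ℝ, Q, E]) :
    T = O + ((S / N * p - δ : ℝ) : ℂ) * Complex.I * e := by
  have h₁ : planeCross e (T - D) * N = S * planeDot e (T - D) := by
    obtain ⟨t, rfl⟩ := exists_eq_add_of_mem_line hTP
    simp only [planeDot, planeCross, Complex.sub_re, Complex.sub_im, Complex.add_re,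
      Complex.add_im, Complex.re_ofReal_mul, Complex.im_ofReal_mul] at hP ⊢
    linear_combination (1 - t) * hP
  have h₂ : planeCross e (T - E) * -N = S * planeDot e (T - E) := by
    obtain ⟨t, rfl⟩ := exists_eq_add_of_mem_line hTQ
    simp only [planeDot, planeCross, Complex.sub_re, Complex.sub_im, Complex.add_re,
      Complex.add_im, Complex.re_ofReal_mul, Complex.im_ofReal_mul] at hQ ⊢
    linear_combination (1 - t) * hQ
  have hdot : planeDot e (T - O) = 0 := by
    apply mul_left_cancel₀ (mul_ne_zero two_ne_zero hS)
    subst hD hE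
    simp [planeDot, planeCross, -mul_eq_mul_left_iff, -mul_eq_zero] at h₁ h₂ ⊢
    linear_combination -h₁ - h₂
  have hcross : planeCross e (T - O) = (S / N * p - δ) * planeDot e e := by
    apply mul_left_cancel₀ hN
    subst hD hE
    have hx : N * (S / N) = S := mul_div_cancel₀ S hN
    simp [planeDot, planeCross, -mul_eq_mul_left_iff, -mul_eq_zero] at h₁ h₂ ⊢
    linear_combination (h₁ - h₂) / 2 - p * (e.re * e.re + e.im * e.im) * hx
  have hTO := eq_mul_of_planeDot_of_planeCross he (hdot.trans (zero_mul _).symm) hcross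
  rw [Complex.ofReal_zero, zero_add] at hTO
  rw [← hTO]
  ring

/-- Points of the line through `A` and the second intersection of the circles `AEF` and `AE'F'`
have distances to the two sides through `A` in the ratio of the chords `EE'` and `FF'`. -/
lemma radical_line_ratio {A B C E E' F F' A' R O : ℂ} {q r δ ε : ℝ}
    (hEl : E ∈ line[ℝ, C, A]) (hE'l : E' ∈ line[ℝ, C, A])
    (hFl : F ∈ line[ℝ, A, B]) (hF'l : F' ∈ line[ℝ, A, B])
    (hAE : A ≠ E) (hAE' : A ≠ E') (hAF : A ≠ F) (hAF' : A ≠ F')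
    (hE : E = O - (δ * Complex.I + q) * (A - C)) (hE' : E' = O + (-δ * Complex.I + q) * (A - C))
    (hF : F = O - (ε * Complex.I + r) * (B - A)) (hF' : F' = O + (-ε * Complex.I + r) * (B - A))
    (h : Cospherical ({A, E, F, A'} : Set ℂ)) (h' : Cospherical ({A, E', F', A'} : Set ℂ))
    (hR : R ∈ line[ℝ, A, A']) :
    planeCross (A - C) (R - A) * (r * planeDot (B - A) (B - A)) =
      planeCross (B - A) (R - A) * (q * planeDot (A - C) (A - C)) := by
  have h₁ := planeCross_mul_planeDot_of_cospherical hAE hAF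
    (exists_eq_add_of_mem_line_right hEl) (exists_eq_add_of_mem_line hFl) h
  have h₂ := planeCross_mul_planeDot_of_cospherical hAE' hAF'
    (exists_eq_add_of_mem_line_right hE'l) (exists_eq_add_of_mem_line hF'l) h'
  have hcE : planeCross (A - C) (A' - E) = planeCross (A - C) (A' - A) := by
    obtain ⟨t, rfl⟩ := exists_eq_add_of_mem_line_right hEl
    simp [planeCross]
    ring
  have hcE' : planeCross (A - C) (A' - E') = planeCross (A - C) (A' - A) := by
    obtain ⟨t, rfl⟩ := exists_eq_add_of_mem_line_right hE'l
    simp [planeCross]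
    ring
  have hcF : planeCross (B - A) (A' - F) = planeCross (B - A) (A' - A) := by
    obtain ⟨t, rfl⟩ := exists_eq_add_of_mem_line hFl
    simp [planeCross]
    ring
  have hcF' : planeCross (B - A) (A' - F') = planeCross (B - A) (A' - A) := by
    obtain ⟨t, rfl⟩ := exists_eq_add_of_mem_line hF'l
    simp [planeCross]
    ring
  have hdE : planeDot (A - C) (A' - E) - planeDot (A - C) (A' - E') =
      2 * q * planeDot (A - C) (A - C) := by
    rw [hE, hE']
    simp [planeDot]
    ring
  have hdF : planeDot (B - A) (A' - F) - planeDot (B - A) (A' - F') =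
      2 * r * planeDot (B - A) (B - A) := by
    rw [hF, hF']
    simp [planeDot]
    ring
  rw [hcE, hcF] at h₁
  rw [hcE', hcF'] at h₂
  have key : planeCross (A - C) (A' - A) * (r * planeDot (B - A) (B - A)) =
      planeCross (B - A) (A' - A) * (q * planeDot (A - C) (A - C)) := by
    linear_combination (h₁ - h₂) / 2 - planeCross (A - C) (A' - A) / 2 * hdF +
      planeCross (B - A) (A' - A) / 2 * hdE
  obtain ⟨t, rfl⟩ := exists_eq_add_of_mem_line hR
  have hlin : ∀ u : ℂ, planeCross u (A + t * (A' - A) - A) = t * planeCross u (A' - A) := by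
    intro u
    simp [planeCross]
    ring
  rw [hlin, hlin]
  linear_combination t * key

/-- The line from `A` parallel to `UV` passes through the circumcenter `K` of the triangle cut off
at `A` by the line `OR`, when `U` and `V` are the points on the perpendiculars from `O` to the
sides through `A` determined by the direction of `OR`. -/
lemma mem_line_circumcenter {A B C O R Y Z U V K S : ℂ} {y z : ℝ}
    (hU : U = O + (y : ℂ) * Complex.I * (A - C)) (hV : V = O + (z : ℂ) * Complex.I * (B - A))
    (hy : planeCross (A - C) (R - O) = y * planeDot (A - C) (A - C))
    (hz : planeCross (B - A) (R - O) = z * planeDot (B - A) (B - A))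
    (hY : Y ∈ line[ℝ, O, R]) (hYl : Y ∈ line[ℝ, C, A])
    (hZ : Z ∈ line[ℝ, O, R]) (hZl : Z ∈ line[ℝ, A, B])
    (hAYZ : AffineIndependent ℝ ![A, Y, Z])
    (hK : dist K A = dist K Y ∧ dist K Y = dist K Z)
    (hS : ∃ t : ℝ, S - A = t • (V - U)) : S ∈ line[ℝ, A, K] := by
  have hYA : Y ≠ A := by
    simpa using hAYZ.injective.ne (show (1 : Fin 3) ≠ 0 by decide)
  have hZA : Z ≠ A := by
    simpa using hAYZ.injective.ne (show (2 : Fin 3) ≠ 0 by decide)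
  have hKA : K - A ≠ 0 := by
    intro h
    obtain rfl := sub_eq_zero.1 h
    have := hK.1
    rw [dist_self] at this
    exact hYA (dist_eq_zero.1 this.symm).symm
  have hn := planeDot_self_ne_zero hKA
  have hYZ : planeCross (Z - Y) (R - O) = 0 := by
    obtain ⟨s, rfl⟩ := exists_eq_add_of_mem_line hY
    obtain ⟨t, rfl⟩ := exists_eq_add_of_mem_line hZ
    simp [planeCross]
    ring
  obtain ⟨η, rfl⟩ := exists_eq_add_of_mem_line_right hYl
  obtain ⟨ζ, rfl⟩ := exists_eq_add_of_mem_line hZl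
  have h₁ := two_mul_planeDot_of_equidistant hYA hK.1
  have h₂ := two_mul_planeDot_of_equidistant hZA (hK.1.trans hK.2)
  have hYZ' : ζ * planeCross (B - A) (R - O) - η * planeCross (A - C) (R - O) = 0 := by
    rw [← hYZ]
    simp [planeCross]
    ring
  have hperp : z * planeDot (K - A) (B - A) - y * planeDot (K - A) (A - C) = 0 := by
    linear_combination z / 2 * h₂ - y / 2 * h₁ + hYZ' / 2 - ζ / 2 * hz + η / 2 * hy
  have hcross : planeCross (K - A) (V - U) = 0 := by
    rw [← hperp, hU, hV]
    simp [planeCross, planeDot]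
    ring
  obtain ⟨t, ht⟩ := hS
  obtain ⟨c, hc⟩ : ∃ c : ℝ, planeDot (K - A) (V - U) = c * planeDot (K - A) (K - A) :=
    ⟨_, (div_mul_cancel₀ _ hn).symm⟩
  have hVU : V - U = c * (K - A) := by
    simpa using eq_mul_of_planeDot_of_planeCross hKA hc (hcross.trans (zero_mul _).symm)
  refine mem_affineSpan_pair_iff_exists_lineMap_eq.2 ⟨t * c, ?_⟩
  have hS' : S = A + (t : ℂ) * (c * (K - A)) := by
    rw [← hVU, ← Complex.real_smul, ← ht]
    ring
  rw [hS']
  simp [AffineMap.lineMap_apply]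
  ring

lemma planeCross_ne_zero_of_affineIndependent {A B C : ℂ}
    (h : AffineIndependent ℝ ![A, B, C]) : planeCross (B - A) (C - A) ≠ 0 := by
  intro h0
  have hBA : B - A ≠ 0 := by
    simpa [sub_eq_zero] using h.injective.ne (show (1 : Fin 3) ≠ 0 by decide)
  have hn := planeDot_self_ne_zero hBA
  apply affineIndependent_iff_not_collinear_set.1 h
  obtain ⟨c, hc⟩ : ∃ c : ℝ, planeDot (B - A) (C - A) = c * planeDot (B - A) (B - A) :=
    ⟨_, (div_mul_cancel₀ _ hn).symm⟩
  refine (collinear_iff_of_mem (p₀ := A) (by simp)).2 ⟨B - A, ?_⟩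
  have hC : C = c • (B - A) +ᵥ A := by
    rw [vadd_eq_add, ← sub_eq_iff_eq_add, Complex.real_smul]
    simpa using eq_mul_of_planeDot_of_planeCross hBA hc (h0.trans (zero_mul _).symm)
  rintro p (rfl | rfl | rfl)
  · exact ⟨0, by simp⟩
  · exact ⟨1, by simp⟩
  · exact ⟨c, hC⟩

theorem ABC_and_circumcenters_perspective_at_steiner_point
    (A B C O : ℂ)
    -- triangle ABC is nondegenerate
    (hABC : AffineIndependent ℝ ![A, B, C])
    -- Γ is a circle with center O meeting the sidelines in the six points
    (Γ : EuclideanGeometry.Sphere ℂ) (hO : Γ.center = O)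
    (A₁ A₂ B₁ B₂ C₁ C₂ : ℂ)
    (hA₁Γ : A₁ ∈ Γ) (hA₂Γ : A₂ ∈ Γ) (hB₁Γ : B₁ ∈ Γ)
    (hB₂Γ : B₂ ∈ Γ) (hC₁Γ : C₁ ∈ Γ) (hC₂Γ : C₂ ∈ Γ)
    (hA₁ : A₁ ∈ line[ℝ, B, C]) (hA₂ : A₂ ∈ line[ℝ, B, C])
    (hB₁ : B₁ ∈ line[ℝ, C, A]) (hB₂ : B₂ ∈ line[ℝ, C, A])
    (hC₁ : C₁ ∈ line[ℝ, A, B]) (hC₂ : C₂ ∈ line[ℝ, A, B])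
    -- the six points are distinct from each other and from the vertices
    (hdist : List.Pairwise (· ≠ ·) [A, B, C, A₁, A₂, B₁, B₂, C₁, C₂])
    -- P is the Miquel point of A₁B₁C₁ in ABC, Q that of A₂B₂C₂
    (P Q : ℂ)
    (hP₁ : Cospherical ({A, B₁, C₁, P} : Set ℂ))
    (hP₂ : Cospherical ({B, C₁, A₁, P} : Set ℂ))
    (hP₃ : Cospherical ({C, A₁, B₁, P} : Set ℂ))
    (hQ₁ : Cospherical ({A, B₂, C₂, Q} : Set ℂ))
    (hQ₂ : Cospherical ({B, C₂, A₂, Q} : Set ℂ))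
    (hQ₃ : Cospherical ({C, A₂, B₂, Q} : Set ℂ))
    -- T_A = PA₁ ∩ QA₂, T_B = PB₁ ∩ QB₂, T_C = PC₁ ∩ QC₂
    (T_A T_B T_C : ℂ)
    (hTA₁ : T_A ∈ line[ℝ, P, A₁]) (hTA₂ : T_A ∈ line[ℝ, Q, A₂])
    (hTB₁ : T_B ∈ line[ℝ, P, B₁]) (hTB₂ : T_B ∈ line[ℝ, Q, B₂])
    (hTC₁ : T_C ∈ line[ℝ, P, C₁]) (hTC₂ : T_C ∈ line[ℝ, Q, C₂])
    (hT : ¬ Collinear ℝ ({T_A, T_B, T_C} : Set ℂ))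
    -- A' is the second intersection of circles (AB₁C₁) and (AB₂C₂); B', C' analogous
    (A' B' C' : ℂ)
    (hA'₁ : Cospherical ({A, B₁, C₁, A'} : Set ℂ))
    (hA'₂ : Cospherical ({A, B₂, C₂, A'} : Set ℂ)) (hA'A : A' ≠ A)
    (hB'₁ : Cospherical ({B, C₁, A₁, B'} : Set ℂ))
    (hB'₂ : Cospherical ({B, C₂, A₂, B'} : Set ℂ)) (hB'B : B' ≠ B)
    (hC'₁ : Cospherical ({C, A₁, B₁, C'} : Set ℂ))
    (hC'₂ : Cospherical ({C, A₂, B₂, C'} : Set ℂ)) (hC'C : C' ≠ C)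
    -- R is the common point of the lines AA', BB', CC'
    (R : ℂ)
    (hRA : R ∈ line[ℝ, A, A']) (hRB : R ∈ line[ℝ, B, B']) (hRC : R ∈ line[ℝ, C, C'])
    -- ω is the circumcircle of triangle ABC
    (ω : EuclideanGeometry.Sphere ℂ)
    (hAω : A ∈ ω) (hBω : B ∈ ω) (hCω : C ∈ ω)
    -- S_t is the common point, on the circumcircle of ABC, of the lines through
    -- A, B, C parallel to T_BT_C, T_CT_A, T_AT_B respectively
    (S_t : ℂ) (hSω : S_t ∈ ω)
    (hSA : ∃ t : ℝ, S_t - A = t • (T_C - T_B))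
    (hSB : ∃ t : ℝ, S_t - B = t • (T_A - T_C))
    (hSC : ∃ t : ℝ, S_t - C = t • (T_B - T_A))
    (hOR : O ≠ R)
    -- X, Y, Z are the intersections of line OR with BC, CA, AB
    (X Y Z : ℂ)
    (hX₁ : X ∈ line[ℝ, O, R]) (hX₂ : X ∈ line[ℝ, B, C])
    (hY₁ : Y ∈ line[ℝ, O, R]) (hY₂ : Y ∈ line[ℝ, C, A])
    (hZ₁ : Z ∈ line[ℝ, O, R]) (hZ₂ : Z ∈ line[ℝ, A, B])
    -- triangles AYZ, BZX, CXY are nondegenerate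
    (hAYZ : AffineIndependent ℝ ![A, Y, Z])
    (hBZX : AffineIndependent ℝ ![B, Z, X])
    (hCXY : AffineIndependent ℝ ![C, X, Y])
    -- O_A, O_B, O_C are the circumcenters of AYZ, BZX, CXY
    (O_A O_B O_C : ℂ)
    (hOA : dist O_A A = dist O_A Y ∧ dist O_A Y = dist O_A Z)
    (hOB : dist O_B B = dist O_B Z ∧ dist O_B Z = dist O_B X)
    (hOC : dist O_C C = dist O_C X ∧ dist O_C X = dist O_C Y) :
    -- conclusion: the lines AO_A, BO_B, CO_C pass through S_t
    S_t ∈ line[ℝ, A, O_A] ∧ S_t ∈ line[ℝ, B, O_B] ∧ S_t ∈ line[ℝ, C, O_C] := by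
  have hS := planeCross_ne_zero_of_affineIndependent hABC
  simp only [List.pairwise_cons, List.mem_cons, List.not_mem_nil, or_false, forall_eq_or_imp,
    forall_eq, IsEmpty.forall_iff, implies_true, List.Pairwise.nil, and_true] at hdist
  obtain ⟨⟨hAB, hAC, -, -, hAB₁, hAB₂, hAC₁, hAC₂⟩, ⟨hBC, hBA₁, hBA₂, -, -, hBC₁, hBC₂⟩,
    ⟨hCA₁, hCA₂, hCB₁, hCB₂, -, -⟩, ⟨hA₁₂, -⟩, -, ⟨hB₁₂, -⟩, -, hC₁₂⟩ := hdist
  have heA : C - B ≠ 0 := sub_ne_zero.2 hBC.symm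
  have heB : A - C ≠ 0 := sub_ne_zero.2 hAC
  have heC : B - A ≠ 0 := sub_ne_zero.2 hAB.symm
  obtain ⟨p, α, hp, hA₁p, hA₂p, hα⟩ := exists_chord_parameters hO hA₁Γ hA₂Γ hA₁ hA₂ hA₁₂
  obtain ⟨q, β, hq, hB₁q, hB₂q, hβ⟩ := exists_chord_parameters hO hB₁Γ hB₂Γ hB₁ hB₂ hB₁₂
  obtain ⟨r, γ, hr, hC₁r, hC₂r, hγ⟩ := exists_chord_parameters hO hC₁Γ hC₂Γ hC₁ hC₂ hC₁₂
  obtain ⟨N, hN⟩ : ∃ N, N = p * planeDot (C - B) (C - B) + q * planeDot (A - C) (A - C) +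
    r * planeDot (B - A) (B - A) := ⟨_, rfl⟩
  have hNP : planeDot (C - B) (P - A₁) + planeDot (A - C) (P - B₁) + planeDot (B - A) (P - C₁) =
      N := by
    rw [hA₁p, hB₁q, hC₁r, hN]
    simp [planeDot]
    ring
  have hNQ : planeDot (C - B) (Q - A₂) + planeDot (A - C) (Q - B₂) + planeDot (B - A) (Q - C₂) =
      -N := by
    rw [hA₂p, hB₂q, hC₂r, hN]
    simp [planeDot]
    ring
  obtain ⟨hPA, hPB, hPC⟩ := miquel_direction hA₁ hB₁ hC₁ hBA₁ hCA₁ hCB₁ hAB₁ hAC₁ hBC₁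
    hP₁ hP₂ hP₃ hNP
  obtain ⟨hQA, hQB, hQC⟩ := miquel_direction hA₂ hB₂ hC₂ hBA₂ hCA₂ hCB₂ hAB₂ hAC₂ hBC₂
    hQ₁ hQ₂ hQ₃ hNQ
  have hA := radical_line_ratio hB₁ hB₂ hC₁ hC₂ hAB₁ hAB₂ hAC₁ hAC₂ hB₁q hB₂q hC₁r hC₂r
    hA'₁ hA'₂ hRA
  have hB := radical_line_ratio hC₁ hC₂ hA₁ hA₂ hBC₁ hBC₂ hBA₁ hBA₂ hC₁r hC₂r hA₁p hA₂p
    hB'₁ hB'₂ hRB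
  have hC := radical_line_ratio hA₁ hA₂ hB₁ hB₂ hCA₁ hCA₂ hCB₁ hCB₂ hA₁p hA₂p hB₁q hB₂q
    hC'₁ hC'₂ hRC
  have shift : ∀ U V W : ℂ, planeCross (V - U) (W - V) = planeCross (V - U) (W - U) := by
    intro U V W
    simp [planeCross]
    ring
  rw [shift] at hA hB hC
  have hsum : planeCross (C - B) (R - B) + planeCross (A - C) (R - C) +
      planeCross (B - A) (R - A) = planeCross (B - A) (C - A) := by
    simp [planeCross]
    ring
  have hRA' : planeCross (C - B) (R - B) * N =
      p * planeDot (C - B) (C - B) * planeCross (B - A) (C - A) := by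
    rw [hN, ← hsum]
    linear_combination hC - hB
  have hRB' : planeCross (A - C) (R - C) * N =
      q * planeDot (A - C) (A - C) * planeCross (B - A) (C - A) := by
    rw [hN, ← hsum]
    linear_combination hA - hC
  have hRC' : planeCross (B - A) (R - A) * N =
      r * planeDot (B - A) (B - A) * planeCross (B - A) (C - A) := by
    rw [hN, ← hsum]
    linear_combination hB - hA
  have hN0 : N ≠ 0 := by
    intro h
    rw [h, mul_zero] at hRA'
    exact mul_ne_zero (mul_ne_zero hp (planeDot_self_ne_zero heA)) hS hRA'.symm
  have hTA := miquel_lines_inter heA hN0 hS hA₁p hA₂p hPA hQA hTA₁ hTA₂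
  have hTB := miquel_lines_inter heB hN0 hS hB₁q hB₂q hPB hQB hTB₁ hTB₂
  have hTC := miquel_lines_inter heC hN0 hS hC₁r hC₂r hPC hQC hTC₁ hTC₂
  have direction : ∀ {U e : ℂ} {x δ : ℝ}, planeCross e (O - U) = δ * planeDot e e →
      planeCross e (R - U) * N = x * planeDot e e * planeCross (B - A) (C - A) →
      planeCross e (R - O) =
        (planeCross (B - A) (C - A) / N * x - δ) * planeDot e e := by
    intro U e x δ h₁ h₂
    have h₃ : planeCross e (R - O) = planeCross e (R - U) - planeCross e (O - U) := by
      simp [planeCross]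
      ring
    rw [h₃, h₁, eq_div_of_mul_eq hN0 h₂]
    ring
  have hdA := direction hα hRA'
  have hdB := direction hβ hRB'
  have hdC := direction hγ hRC'
  exact ⟨mem_line_circumcenter hTB hTC hdB hdC hY₁ hY₂ hZ₁ hZ₂ hAYZ hOA hSA,
    mem_line_circumcenter hTC hTA hdC hdA hZ₁ hZ₂ hX₁ hX₂ hBZX hOB hSB,
    mem_line_circumcenter hTA hTB hdA hdB hX₁ hX₂ hY₁ hY₂ hCXY hOC hSC⟩
end
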